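/- arXiv:2504.16744 — 3 statements merged into one kernel-verified Lean document; each statement's English description precedes it below -/
import Mathlib

section
/- Let U be a nonempty finite universe, S = {S_1,…,S_k} a finite family of subsets of U with ⋃_{i} S_i = U, φ a natural number, and α ∈ (0,1) rational. Construct the digraph G=(V,E): V consists of pairwise distinct vertices v_u and v'_u for each u ∈ U, vertices v_S and z_S for each S ∈ S, and one vertex t; E = E_U ∪ E_S ∪ E_1, where E_U = {(v_u,t), (v'_u,t) : u ∈ U}, E_S = {(v_S,t) : S ∈ S}, and E_1 = {(v_u,v_S), (v'_u,v_S) : S ∈ S, u ∈ S} ∪ {(v_S,z_S), (z_S,t) : S ∈ S}. Fix a rational ε with 0 < ε ≤ min((1−α)/(2α²·|U|), (1−α)/α), and set cap(e) = 1 for e ∈ E_1, cap(e) = (1−α)/α for e ∈ E_S, and cap(e) = ε for e ∈ E_U. Let ψ = |E_1| + φ. Then there exists A ⊆ E with |A| ≤ ψ in which the scaled matrix α·T_E is routable if and only if there exists a subfamily C ⊆ S with |C| ≤ φ and ⋃_{S∈C} S = U. -/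
open Finset

variable {V : Type*}

/-- A flow for the commodity `(s,t)` of value `d`, supported on the edge set `E`. -/
def IsFlow [Fintype V] [DecidableEq V] (E : Finset (V × V)) (s t : V) (d : ℚ)
    (f : V × V → ℚ) : Prop :=
  (∀ e, 0 ≤ f e) ∧ (∀ e, e ∉ E → f e = 0) ∧
    ∀ v : V,
      ((∑ e ∈ E.filter (fun e => e.2 = v), f e) -
          ∑ e ∈ E.filter (fun e => e.1 = v), f e) =
        (if v = t then d else 0) - (if v = s then d else 0)

/-- The traffic matrix `T` is routable in the edge set `A ⊆ E` via a multi-commodity flow. -/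
def Routable [Fintype V] [DecidableEq V] (E : Finset (V × V)) (cap : V × V → ℚ)
    (T : V × V → ℚ) (A : Finset (V × V)) : Prop :=
  ∃ f : V × V → V × V → ℚ,
    (∀ p : V × V, IsFlow E p.1 p.2 (T p) (f p)) ∧
    (∀ e ∈ E, (∑ p : V × V, f p e) ≤ cap e) ∧
    (∀ e ∈ E, e ∉ A → (∑ p : V × V, f p e) = 0)

/-- The traffic matrix `T_E` demanding `cap e` for each edge `e ∈ E` and `0` otherwise. -/
def trafficTE [Fintype V] [DecidableEq V] (E : Finset (V × V)) (cap : V × V → ℚ) :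
    V × V → ℚ := fun p => if p ∈ E then cap p else 0

/-- A traffic matrix is a nonnegative function on pairs of vertices. -/
def IsTrafficMatrix (T : V × V → ℚ) : Prop := ∀ p, 0 ≤ T p

/-- Vertex set of the Set Cover reduction: `v_u` and `v'_u` for each `u ∈ U`,
`v_S` and `z_S` for each set index `i : Fin k`, and one sink vertex `t`. -/
abbrev SCV (U : Type*) (k : ℕ) := (U ⊕ U) ⊕ ((Fin k ⊕ Fin k) ⊕ Unit)

def scVu {U : Type*} {k : ℕ} (u : U) : SCV U k := Sum.inl (Sum.inl u)
def scVu' {U : Type*} {k : ℕ} (u : U) : SCV U k := Sum.inl (Sum.inr u)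
def scVS {U : Type*} {k : ℕ} (i : Fin k) : SCV U k := Sum.inr (Sum.inl (Sum.inl i))
def scZS {U : Type*} {k : ℕ} (i : Fin k) : SCV U k := Sum.inr (Sum.inl (Sum.inr i))
def scT (U : Type*) (k : ℕ) : SCV U k := Sum.inr (Sum.inr ())

/-- The item edges `E_U = {(v_u, t), (v'_u, t) : u ∈ U}`. -/
def scEU (U : Type*) [Fintype U] [DecidableEq U] (k : ℕ) : Finset (SCV U k × SCV U k) :=
  Finset.univ.image (fun u : U => (scVu u, scT U k)) ∪
    Finset.univ.image (fun u : U => (scVu' u, scT U k))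

/-- The set edges `E_S = {(v_S, t) : S ∈ 𝒮}`. -/
def scES (U : Type*) [Fintype U] [DecidableEq U] (k : ℕ) : Finset (SCV U k × SCV U k) :=
  Finset.univ.image (fun i : Fin k => (scVS i, scT U k))

/-- The edges `E_1 = {(v_u, v_S), (v'_u, v_S) : u ∈ S} ∪ {(v_S, z_S), (z_S, t) : S ∈ 𝒮}`. -/
def scE1 (U : Type*) [Fintype U] [DecidableEq U] (k : ℕ) (S : Fin k → Finset U) :
    Finset (SCV U k × SCV U k) :=
  ((Finset.univ : Finset (U × Fin k)).filter (fun p => p.1 ∈ S p.2)).image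
      (fun p => (scVu p.1, scVS p.2)) ∪
    ((Finset.univ : Finset (U × Fin k)).filter (fun p => p.1 ∈ S p.2)).image
      (fun p => (scVu' p.1, scVS p.2)) ∪
    Finset.univ.image (fun i : Fin k => (scVS i, scZS i)) ∪
    Finset.univ.image (fun i : Fin k => (scZS i, scT U k))

/-- The full edge set `E = E_U ∪ E_S ∪ E_1`. -/
def scE (U : Type*) [Fintype U] [DecidableEq U] (k : ℕ) (S : Fin k → Finset U) :
    Finset (SCV U k × SCV U k) :=
  scEU U k ∪ scES U k ∪ scE1 U k S

/-- The capacities: `1` on `E_1`, `(1-α)/α` on `E_S`, and `ε` on `E_U`. -/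
def scCap (U : Type*) [Fintype U] [DecidableEq U] (k : ℕ) (S : Fin k → Finset U)
    (α ε : ℚ) : SCV U k × SCV U k → ℚ :=
  fun e => if e ∈ scE1 U k S then 1 else if e ∈ scES U k then (1 - α) / α else ε

namespace IsFlow

variable [Fintype V] [DecidableEq V] {E : Finset (V × V)} {s m t v : V} {d : ℚ}
  {f g : V × V → ℚ}

theorem zero (E : Finset (V × V)) (s t : V) : IsFlow E s t 0 (fun _ => 0) := by
  simp [IsFlow]

theorem single (h : (s, t) ∈ E) (hd : 0 ≤ d) :
    IsFlow E s t d (fun e => if e = (s, t) then d else 0) := by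
  refine ⟨fun e => by dsimp only; split_ifs <;> simp [hd], fun e he => ?_, fun v => ?_⟩
  · exact if_neg (ne_of_mem_of_not_mem h he).symm
  · simp only [Finset.sum_ite_eq', Finset.mem_filter, h, true_and, eq_comm]

theorem trans (hf : IsFlow E s m d f) (hg : IsFlow E m t d g) :
    IsFlow E s t d (fun e => f e + g e) := by
  refine ⟨fun e => add_nonneg (hf.1 e) (hg.1 e), fun e he => ?_, fun v => ?_⟩
  · simp [hf.2.1 e he, hg.2.1 e he]
  · have h₁ := hf.2.2 v
    have h₂ := hg.2.2 v
    simp only [Finset.sum_add_distrib]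
    linarith

theorem le_sum_out (h : IsFlow E s t d f) (hst : s ≠ t) :
    d ≤ ∑ e ∈ E.filter (fun e => e.1 = s), f e := by
  have h₁ := h.2.2 s
  have h₂ : 0 ≤ ∑ e ∈ E.filter (fun e => e.2 = s), f e := Finset.sum_nonneg fun e _ => h.1 e
  simp only [hst, if_true, if_false] at h₁
  linarith

theorem le_sum_in (h : IsFlow E s t d f) (hst : s ≠ t) :
    d ≤ ∑ e ∈ E.filter (fun e => e.2 = t), f e := by
  have h₁ := h.2.2 t
  have h₂ : 0 ≤ ∑ e ∈ E.filter (fun e => e.1 = t), f e := Finset.sum_nonneg fun e _ => h.1 e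
  simp only [hst.symm, if_true, if_false] at h₁
  linarith

theorem sum_le_of_unique (h : IsFlow E s t d f) {F : Finset (V × V)} (e₀ : V × V)
    (hF : ∀ e ∈ F, e ≠ e₀ → f e = 0) : ∑ e ∈ F, f e ≤ f e₀ := by
  by_cases he : e₀ ∈ F
  · exact (Finset.sum_eq_single_of_mem e₀ he hF).le
  · rw [Finset.sum_eq_zero fun e h' => hF e h' (ne_of_mem_of_not_mem h' he)]
    exact h.1 e₀

theorem le_of_unique_out (h : IsFlow E s t d f) (hst : s ≠ t) (e₀ : V × V)
    (hu : ∀ e ∈ E, e.1 = s → e ≠ e₀ → f e = 0) : d ≤ f e₀ :=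
  (h.le_sum_out hst).trans <| h.sum_le_of_unique e₀ fun e he =>
    hu e (Finset.mem_filter.1 he).1 (Finset.mem_filter.1 he).2

theorem le_of_unique_in (h : IsFlow E s t d f) (hst : s ≠ t) (e₀ : V × V)
    (hu : ∀ e ∈ E, e.2 = t → e ≠ e₀ → f e = 0) : d ≤ f e₀ :=
  (h.le_sum_in hst).trans <| h.sum_le_of_unique e₀ fun e he =>
    hu e (Finset.mem_filter.1 he).1 (Finset.mem_filter.1 he).2

theorem exists_pos_out (h : IsFlow E s t d f) (hst : s ≠ t) (hd : 0 < d) :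
    ∃ e ∈ E, e.1 = s ∧ 0 < f e := by
  by_contra! hc
  refine (hd.trans_le (h.le_sum_out hst)).not_ge (Finset.sum_nonpos fun e he => ?_)
  exact hc e (Finset.mem_filter.1 he).1 (Finset.mem_filter.1 he).2

theorem exists_pos_out_of_pos_in (h : IsFlow E s t d f) (hs : v ≠ s) (ht : v ≠ t)
    {e : V × V} (he : e ∈ E) (hev : e.2 = v) (hpos : 0 < f e) :
    ∃ e' ∈ E, e'.1 = v ∧ 0 < f e' := by
  by_contra! hc
  have h₁ := h.2.2 v
  have h₂ : ∑ e ∈ E.filter (fun e => e.1 = v), f e ≤ 0 := Finset.sum_nonpos fun e he =>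
    hc e (Finset.mem_filter.1 he).1 (Finset.mem_filter.1 he).2
  have h₃ : f e ≤ ∑ e ∈ E.filter (fun e => e.2 = v), f e :=
    Finset.single_le_sum (f := f) (fun e _ => h.1 e) (Finset.mem_filter.2 ⟨he, hev⟩)
  simp only [hs, ht, if_false] at h₁
  linarith

theorem eq_zero_of_no_in (h : IsFlow E s t d f) (hs : v ≠ s) (ht : v ≠ t)
    (hv : ∀ e ∈ E, e.2 ≠ v) {e : V × V} (he : e ∈ E) (hev : e.1 = v) : f e = 0 := by
  have h₁ := h.2.2 v
  rw [Finset.filter_eq_empty_iff.2 fun e he => hv e he] at h₁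
  have h₃ : f e ≤ ∑ e ∈ E.filter (fun e => e.1 = v), f e :=
    Finset.single_le_sum (f := f) (fun e _ => h.1 e) (Finset.mem_filter.2 ⟨he, hev⟩)
  simp only [hs, ht, if_false, Finset.sum_empty] at h₁
  linarith [h.1 e]

end IsFlow

section SetCover

variable {U : Type*} [Fintype U] [DecidableEq U] {k : ℕ} {S : Fin k → Finset U}

theorem mem_scE1 {e : SCV U k × SCV U k} :
    e ∈ scE1 U k S ↔
      (∃ u i, u ∈ S i ∧ e = (scVu u, scVS i)) ∨ (∃ u i, u ∈ S i ∧ e = (scVu' u, scVS i)) ∨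
        (∃ i, e = (scVS i, scZS i)) ∨ ∃ i, e = (scZS i, scT U k) := by
  simp only [scE1, Finset.mem_union, Finset.mem_image, Finset.mem_filter, Finset.mem_univ,
    true_and, Prod.exists, or_assoc, eq_comm]

theorem mem_scE {e : SCV U k × SCV U k} :
    e ∈ scE U k S ↔
      e ∈ scE1 U k S ∨ (∃ u, e = (scVu u, scT U k)) ∨ (∃ u, e = (scVu' u, scT U k)) ∨
        ∃ i, e = (scVS i, scT U k) := by
  simp only [scE, scEU, scES, Finset.mem_union, Finset.mem_image, Finset.mem_univ, true_and,
    @eq_comm _ e]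
  tauto

theorem scE1_subset_scE : scE1 U k S ⊆ scE U k S := fun _ he => mem_scE.2 (Or.inl he)

theorem scVu_scT_notMem_scE1 (u : U) : (scVu u, scT U k) ∉ scE1 U k S := by
  simp [mem_scE1, scVu, scVu', scVS, scZS, scT]

theorem scVu'_scT_notMem_scE1 (u : U) : (scVu' u, scT U k) ∉ scE1 U k S := by
  simp [mem_scE1, scVu, scVu', scVS, scZS, scT]

theorem scVS_scT_notMem_scE1 (i : Fin k) : (scVS i, scT U k) ∉ scE1 U k S := by
  simp [mem_scE1, scVu, scVu', scVS, scZS, scT]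

theorem scCap_of_mem_scE1 {α ε : ℚ} {e : SCV U k × SCV U k} (he : e ∈ scE1 U k S) :
    scCap U k S α ε e = 1 := if_pos he

theorem scCap_scVu (α ε : ℚ) (u : U) : scCap U k S α ε (scVu u, scT U k) = ε := by
  rw [scCap, if_neg (scVu_scT_notMem_scE1 u), if_neg]
  simp [scES, scVS, scVu]

theorem scCap_scVu' (α ε : ℚ) (u : U) : scCap U k S α ε (scVu' u, scT U k) = ε := by
  rw [scCap, if_neg (scVu'_scT_notMem_scE1 u), if_neg]
  simp [scES, scVS, scVu']

theorem scCap_scVS (α ε : ℚ) (i : Fin k) :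
    scCap U k S α ε (scVS i, scT U k) = (1 - α) / α := by
  rw [scCap, if_neg (scVS_scT_notMem_scE1 i), if_pos]
  simp [scES]

/-- The scaled traffic matrix of the reduction. -/
abbrev scTraffic (S : Fin k → Finset U) (α ε : ℚ) : SCV U k × SCV U k → ℚ :=
  fun p => α * trafficTE (scE U k S) (scCap U k S α ε) p

theorem scTraffic_of_mem {α ε : ℚ} {e : SCV U k × SCV U k} (he : e ∈ scE U k S) :
    scTraffic S α ε e = α * scCap U k S α ε e := by
  rw [scTraffic, trafficTE, if_pos he]

theorem ne_scVu_of_mem_scE {e : SCV U k × SCV U k} (he : e ∈ scE U k S) (u : U) :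
    e.2 ≠ scVu u := by
  rintro h
  simp only [mem_scE, mem_scE1] at he
  rcases he with (⟨w, j, -, rfl⟩ | ⟨w, j, -, rfl⟩ | ⟨j, rfl⟩ | ⟨j, rfl⟩) | ⟨w, rfl⟩ | ⟨w, rfl⟩ |
    ⟨j, rfl⟩ <;> simp_all [scVu, scVS, scZS, scT]

theorem ne_scVu'_of_mem_scE {e : SCV U k × SCV U k} (he : e ∈ scE U k S) (u : U) :
    e.2 ≠ scVu' u := by
  rintro h
  simp only [mem_scE, mem_scE1] at he
  rcases he with (⟨w, j, -, rfl⟩ | ⟨w, j, -, rfl⟩ | ⟨j, rfl⟩ | ⟨j, rfl⟩) | ⟨w, rfl⟩ | ⟨w, rfl⟩ |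
    ⟨j, rfl⟩ <;> simp_all [scVu', scVS, scZS, scT]

theorem source_of_snd_eq_scVS {e : SCV U k × SCV U k} (he : e ∈ scE U k S) {i : Fin k}
    (h : e.2 = scVS i) : ∃ u, e.1 = scVu u ∨ e.1 = scVu' u := by
  simp only [mem_scE, mem_scE1] at he
  rcases he with (⟨w, j, -, rfl⟩ | ⟨w, j, -, rfl⟩ | ⟨j, rfl⟩ | ⟨j, rfl⟩) | ⟨w, rfl⟩ | ⟨w, rfl⟩ |
    ⟨j, rfl⟩ <;> simp_all [scVu, scVu', scVS, scZS, scT]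

theorem eq_of_snd_eq_scZS {e : SCV U k × SCV U k} (he : e ∈ scE U k S) {i : Fin k}
    (h : e.2 = scZS i) : e = (scVS i, scZS i) := by
  simp only [mem_scE, mem_scE1] at he
  rcases he with (⟨w, j, -, rfl⟩ | ⟨w, j, -, rfl⟩ | ⟨j, rfl⟩ | ⟨j, rfl⟩) | ⟨w, rfl⟩ | ⟨w, rfl⟩ |
    ⟨j, rfl⟩ <;> simp_all [scVS, scZS, scT]

theorem eq_of_fst_eq_scZS {e : SCV U k × SCV U k} (he : e ∈ scE U k S) {i : Fin k}
    (h : e.1 = scZS i) : e = (scZS i, scT U k) := by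
  simp only [mem_scE, mem_scE1] at he
  rcases he with (⟨w, j, -, rfl⟩ | ⟨w, j, -, rfl⟩ | ⟨j, rfl⟩ | ⟨j, rfl⟩) | ⟨w, rfl⟩ | ⟨w, rfl⟩ |
    ⟨j, rfl⟩ <;> simp_all [scVu, scVu', scVS, scZS, scT]

theorem eq_of_fst_eq_scVS {e : SCV U k × SCV U k} (he : e ∈ scE U k S) {i : Fin k}
    (h : e.1 = scVS i) : e = (scVS i, scZS i) ∨ e = (scVS i, scT U k) := by
  simp only [mem_scE, mem_scE1] at he
  rcases he with (⟨w, j, -, rfl⟩ | ⟨w, j, -, rfl⟩ | ⟨j, rfl⟩ | ⟨j, rfl⟩) | ⟨w, rfl⟩ | ⟨w, rfl⟩ |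
    ⟨j, rfl⟩ <;> simp_all [scVu, scVu', scVS, scZS, scT]

theorem eq_of_fst_eq_scVu {e : SCV U k × SCV U k} (he : e ∈ scE U k S) {u : U}
    (h : e.1 = scVu u) :
    (∃ i, u ∈ S i ∧ e = (scVu u, scVS i)) ∨ e = (scVu u, scT U k) := by
  simp only [mem_scE, mem_scE1] at he
  rcases he with (⟨w, j, hj, rfl⟩ | ⟨w, j, -, rfl⟩ | ⟨j, rfl⟩ | ⟨j, rfl⟩) | ⟨w, rfl⟩ | ⟨w, rfl⟩ |
    ⟨j, rfl⟩ <;> simp_all [scVu, scVu', scVS, scZS, scT]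

theorem IsFlow.le_of_mem_scE1 {d : ℚ} {e : SCV U k × SCV U k} {f : SCV U k × SCV U k → ℚ}
    (he : e ∈ scE1 U k S) (h : IsFlow (scE U k S) e.1 e.2 d f) : d ≤ f e := by
  have hVS {w : SCV U k} {i : Fin k} (hw : w ≠ scVS i)
      (h : IsFlow (scE U k S) w (scVS i) d f) : d ≤ f (w, scVS i) := by
    refine h.le_of_unique_in hw _ fun e' he' h₂ hne => ?_
    refine h.eq_zero_of_no_in (v := e'.1) (fun h₁ => hne (Prod.ext h₁ h₂)) ?_ ?_ he' rfl
    · obtain ⟨w, hw | hw⟩ := source_of_snd_eq_scVS he' h₂ <;> simp [hw, scVu, scVu', scVS]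
    · intro e'' he''
      obtain ⟨w, hw | hw⟩ := source_of_snd_eq_scVS he' h₂ <;> rw [hw]
      exacts [ne_scVu_of_mem_scE he'' w, ne_scVu'_of_mem_scE he'' w]
  rcases mem_scE1.1 he with ⟨u, i, -, rfl⟩ | ⟨u, i, -, rfl⟩ | ⟨i, rfl⟩ | ⟨i, rfl⟩
  · exact hVS (by simp [scVu, scVS]) h
  · exact hVS (by simp [scVu', scVS]) h
  · exact h.le_of_unique_in (by simp [scVS, scZS]) _ fun e' he' h₂ hne =>
      absurd (eq_of_snd_eq_scZS he' h₂) hne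
  · exact h.le_of_unique_out (by simp [scT, scZS]) _ fun e' he' h₁ hne =>
      absurd (eq_of_fst_eq_scZS he' h₁) hne

theorem exists_cover_of_routable (hcov : ∀ u : U, ∃ i, u ∈ S i) [Nonempty U] {φ : ℕ} {α ε : ℚ}
    (h0 : 0 < α) (hε0 : 0 < ε) {A : Finset (SCV U k × SCV U k)}
    (hr : Routable (scE U k S) (scCap U k S α ε) (scTraffic S α ε) A)
    (hcard : A.card ≤ (scE1 U k S).card + φ) :
    ∃ C : Finset (Fin k), C.card ≤ φ ∧ ∀ u : U, ∃ i ∈ C, u ∈ S i := by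
  obtain ⟨f, hf, hcap, hzero⟩ := hr
  have hA {p e : SCV U k × SCV U k} (he : e ∈ scE U k S) (hpos : 0 < f p e) : e ∈ A := by
    by_contra h
    exact hpos.ne' ((Finset.sum_eq_zero_iff_of_nonneg fun p _ => (hf p).1 e).1
      (hzero e he h) p (Finset.mem_univ _))
  have hE1 {e : SCV U k × SCV U k} (he : e ∈ scE1 U k S) : α ≤ f e e := by
    have := (hf e).le_of_mem_scE1 he
    rwa [scTraffic_of_mem (scE1_subset_scE he), scCap_of_mem_scE1 he, mul_one] at this
  have hsub : scE1 U k S ⊆ A := fun e he => hA (scE1_subset_scE he) (h0.trans_le (hE1 he))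
  have key (u : U) (hu : (scVu u, scT U k) ∉ A) : ∃ i, u ∈ S i ∧ (scVS i, scT U k) ∈ A := by
    by_contra! hc
    have hmem : (scVu u, scT U k) ∈ scE U k S := mem_scE.2 (by simp)
    have hflow := hf (scVu u, scT U k)
    rw [scTraffic_of_mem hmem, scCap_scVu] at hflow
    obtain ⟨e, he, he1, hpos⟩ := hflow.exists_pos_out (by simp [scVu, scT]) (by positivity)
    obtain ⟨i, hi, rfl⟩ | rfl := eq_of_fst_eq_scVu he he1
    swap
    · exact hu (hA he hpos)
    obtain ⟨e, he', he1', hpos'⟩ := hflow.exists_pos_out_of_pos_in (v := scVS i)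
      (by simp [scVu, scVS]) (by simp [scT, scVS]) he rfl hpos
    obtain rfl | rfl := eq_of_fst_eq_scVS he' he1'
    swap
    · exact hc i hi (hA he' hpos')
    have hz : (scVS i, scZS i) ∈ scE1 U k S :=
      mem_scE1.2 (Or.inr (Or.inr (Or.inl ⟨i, rfl⟩)))
    have hmemS : (scVS i, scT U k) ∈ scE U k S := mem_scE.2 (by simp)
    have hflowS := hf (scVS i, scT U k)
    rw [scTraffic_of_mem hmemS, scCap_scVS, mul_div_cancel₀ _ h0.ne'] at hflowS
    have hS := hflowS.le_of_unique_out (by simp [scVS, scT]) (scVS i, scZS i)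
      fun e he h1 hne => by
        obtain rfl | rfl := eq_of_fst_eq_scVS he h1
        · exact absurd rfl hne
        · by_contra h
          exact hc i hi (hA he (lt_of_le_of_ne (hflowS.1 _) (Ne.symm h)))
    have hle := hcap _ he'
    rw [scCap_of_mem_scE1 hz] at hle
    have hsum := Finset.sum_le_univ_sum_of_nonneg
      (s := {(scVu u, scT U k), (scVS i, scT U k), (scVS i, scZS i)})
      (fun p => (hf p).1 (scVS i, scZS i))
    rw [Finset.sum_insert (by simp [scVu, scVS]), Finset.sum_pair (by simp [scT, scZS])] at hsum
    linarith [hE1 hz]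
  choose c hc using hcov
  let g : SCV U k × SCV U k → Fin k := fun e =>
    Sum.elim (Sum.elim c c) (Sum.elim (Sum.elim id id) fun _ => c (Classical.arbitrary U)) e.1
  refine ⟨(A \ scE1 U k S).image g, Finset.card_image_le.trans ?_, fun u => ?_⟩
  · rw [Finset.card_sdiff_of_subset hsub]
    omega
  · by_cases hu : (scVu u, scT U k) ∈ A
    · exact ⟨c u, Finset.mem_image.2 ⟨_, Finset.mem_sdiff.2 ⟨hu, scVu_scT_notMem_scE1 u⟩, rfl⟩,
        hc u⟩
    · obtain ⟨i, hi, hiA⟩ := key u hu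
      exact ⟨i, Finset.mem_image.2 ⟨_, Finset.mem_sdiff.2 ⟨hiA, scVS_scT_notMem_scE1 i⟩, rfl⟩,
        hi⟩

/-- The intermediate vertex of the detour replacing the direct edge from a vertex to `t`, where
`c` assigns to each item the set routing its demand. -/
def scMid (c : U → Fin k) : SCV U k → SCV U k :=
  Sum.elim (Sum.elim (fun u => scVS (c u)) (fun u => scVS (c u)))
    (Sum.elim (Sum.elim scZS scZS) fun _ => scT U k)

/-- The flows sending the demands on `E_1` directly and all other demands over `scMid`. -/
def scRoute (S : Fin k → Finset U) (α ε : ℚ) (c : U → Fin k) (p e : SCV U k × SCV U k) : ℚ :=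
  if p ∈ scE1 U k S then if e = p then scTraffic S α ε p else 0
  else if p ∈ scE U k S then
    (if e = (p.1, scMid c p.1) then scTraffic S α ε p else 0) +
      if e = (scMid c p.1, p.2) then scTraffic S α ε p else 0
  else 0

variable {α ε : ℚ} {c : U → Fin k}

theorem scTraffic_nonneg (h0 : 0 < α) (h1 : α < 1) (hε0 : 0 < ε) (p : SCV U k × SCV U k) :
    0 ≤ scTraffic S α ε p := by
  have : 0 ≤ (1 - α) / α := div_nonneg (by linarith) h0.le
  refine mul_nonneg h0.le ?_
  unfold trafficTE scCap
  split_ifs <;> first | exact zero_le_one | exact le_rfl | exact this | exact hε0.le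

theorem scMid_edges_mem (hc : ∀ u, u ∈ S (c u)) {p : SCV U k × SCV U k} (hp : p ∈ scE U k S)
    (hp1 : p ∉ scE1 U k S) :
    (p.1, scMid c p.1) ∈ scE1 U k S ∧
      ((scMid c p.1, p.2) ∈ scE1 U k S ∨ ∃ u, (scMid c p.1, p.2) = (scVS (c u), scT U k)) := by
  rcases mem_scE.1 hp with h | ⟨u, rfl⟩ | ⟨u, rfl⟩ | ⟨i, rfl⟩
  · exact absurd h hp1
  · exact ⟨mem_scE1.2 (Or.inl ⟨u, c u, hc u, rfl⟩), Or.inr ⟨u, rfl⟩⟩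
  · exact ⟨mem_scE1.2 (Or.inr (Or.inl ⟨u, c u, hc u, rfl⟩)), Or.inr ⟨u, rfl⟩⟩
  · exact ⟨mem_scE1.2 (Or.inr (Or.inr (Or.inl ⟨i, rfl⟩))),
      Or.inl (mem_scE1.2 (Or.inr (Or.inr (Or.inr ⟨i, rfl⟩))))⟩

theorem scRoute_isFlow (hc : ∀ u, u ∈ S (c u)) (h0 : 0 < α) (h1 : α < 1) (hε0 : 0 < ε)
    (p : SCV U k × SCV U k) :
    IsFlow (scE U k S) p.1 p.2 (scTraffic S α ε p) (scRoute S α ε c p) := by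
  have hd := scTraffic_nonneg (S := S) h0 h1 hε0 p
  unfold scRoute
  by_cases hp1 : p ∈ scE1 U k S
  · simp only [hp1, if_true]
    exact IsFlow.single (scE1_subset_scE hp1) hd
  by_cases hp : p ∈ scE U k S
  · simp only [hp1, hp, if_true, if_false]
    obtain ⟨h₁, h₂⟩ := scMid_edges_mem hc hp hp1
    refine (IsFlow.single (scE1_subset_scE h₁) hd).trans (IsFlow.single ?_ hd)
    obtain h₂ | ⟨u, h₂⟩ := h₂
    · exact scE1_subset_scE h₂
    · exact h₂ ▸ mem_scE.2 (by simp)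
  · simp only [hp1, hp, if_false]
    have : scTraffic S α ε p = 0 := by simp [scTraffic, trafficTE, hp]
    rw [this]
    exact IsFlow.zero _ _ _

theorem mem_of_scRoute_ne_zero (hc : ∀ u, u ∈ S (c u)) {p e : SCV U k × SCV U k}
    (h : scRoute S α ε c p e ≠ 0) : e ∈ scE1 U k S ∨ ∃ u, e = (scVS (c u), scT U k) := by
  by_contra! hn
  refine h ?_
  unfold scRoute
  by_cases hp1 : p ∈ scE1 U k S
  · rw [if_pos hp1, if_neg (ne_of_mem_of_not_mem hp1 hn.1).symm]
  by_cases hp : p ∈ scE U k S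
  · obtain ⟨h₁, h₂⟩ := scMid_edges_mem hc hp hp1
    rw [if_neg hp1, if_pos hp, if_neg (ne_of_mem_of_not_mem h₁ hn.1).symm, if_neg, add_zero]
    rintro rfl
    obtain h₂ | ⟨u, h₂⟩ := h₂
    exacts [hn.1 h₂, hn.2 u h₂]
  · rw [if_neg hp1, if_neg hp]

theorem scRoute_le (h0 : 0 < α) (h1 : α < 1) (hε0 : 0 < ε) (p e : SCV U k × SCV U k) :
    scRoute S α ε c p e ≤ scTraffic S α ε p := by
  have hd := scTraffic_nonneg (S := S) h0 h1 hε0 p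
  unfold scRoute
  by_cases hp1 : p ∈ scE1 U k S
  · rw [if_pos hp1]
    split_ifs <;> simp [hd]
  by_cases hp : p ∈ scE U k S
  · have hne : (p.1, scMid c p.1) ≠ (scMid c p.1, p.2) := by
      rcases mem_scE.1 hp with h | ⟨u, rfl⟩ | ⟨u, rfl⟩ | ⟨i, rfl⟩
      · exact absurd h hp1
      all_goals simp [scMid, scVu, scVu', scVS, scZS, scT]
    rw [if_neg hp1, if_pos hp]
    split_ifs with h₁ h₂
    · exact absurd (h₁.symm.trans h₂) hne
    all_goals simp [hd]
  · simpa [hp1, hp] using hd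

theorem sum_scRoute_le (h0 : 0 < α) (h1 : α < 1) (hε0 : 0 < ε) {e : SCV U k × SCV U k}
    (B : Finset (SCV U k × SCV U k)) (hB : ∀ p ∉ B, scRoute S α ε c p e = 0) :
    ∑ p, scRoute S α ε c p e ≤ ∑ p ∈ B, scTraffic S α ε p := by
  rw [← Finset.sum_subset (Finset.subset_univ B) fun p _ hp => hB p hp]
  exact Finset.sum_le_sum fun p _ => scRoute_le h0 h1 hε0 p e

theorem scRoute_eq_zero {p e : SCV U k × SCV U k} (he : p ∈ scE1 U k S → e ≠ p)
    (hu : ∀ u, p = (scVu u, scT U k) →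
      e ≠ (scVu u, scVS (c u)) ∧ e ≠ (scVS (c u), scT U k))
    (hu' : ∀ u, p = (scVu' u, scT U k) →
      e ≠ (scVu' u, scVS (c u)) ∧ e ≠ (scVS (c u), scT U k))
    (hS : ∀ i, p = (scVS i, scT U k) → e ≠ (scVS i, scZS i) ∧ e ≠ (scZS i, scT U k)) :
    scRoute S α ε c p e = 0 := by
  unfold scRoute
  by_cases hp1 : p ∈ scE1 U k S
  · rw [if_pos hp1, if_neg (he hp1)]
  by_cases hp : p ∈ scE U k S
  · rw [if_neg hp1, if_pos hp]
    rcases mem_scE.1 hp with h | ⟨u, rfl⟩ | ⟨u, rfl⟩ | ⟨i, rfl⟩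
    · exact absurd h hp1
    · exact (congrArg₂ _ (if_neg (hu u rfl).1) (if_neg (hu u rfl).2)).trans (add_zero 0)
    · exact (congrArg₂ _ (if_neg (hu' u rfl).1) (if_neg (hu' u rfl).2)).trans (add_zero 0)
    · exact (congrArg₂ _ (if_neg (hS i rfl).1) (if_neg (hS i rfl).2)).trans (add_zero 0)
  · rw [if_neg hp1, if_neg hp]

theorem sum_scTraffic_scEU_le (h0 : 0 < α) (hε0 : 0 < ε) :
    ∑ p ∈ scEU U k, scTraffic S α ε p ≤ 2 * Fintype.card U * (α * ε) := by
  have hval : ∀ p ∈ scEU U k, scTraffic S α ε p ≤ α * ε := by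
    intro p hp
    have hpE : p ∈ scE U k S := by simp [scE, hp]
    rw [scTraffic_of_mem hpE]
    simp only [scEU, Finset.mem_union, Finset.mem_image, Finset.mem_univ, true_and] at hp
    obtain ⟨u, rfl⟩ | ⟨u, rfl⟩ := hp
    · rw [scCap_scVu]
    · rw [scCap_scVu']
  have hcard : (scEU U k).card ≤ 2 * Fintype.card U := by
    refine (Finset.card_union_le _ _).trans ?_
    rw [two_mul]
    exact add_le_add Finset.card_image_le Finset.card_image_le
  refine (Finset.sum_le_card_nsmul _ _ _ hval).trans ?_
  rw [nsmul_eq_mul]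
  exact mul_le_mul_of_nonneg_right (mod_cast hcard) (by positivity)

theorem sum_scRoute_le_scCap (h0 : 0 < α) (h1 : α < 1) (hε0 : 0 < ε)
    (hε : ε ≤ (1 - α) / α) (hεU : 2 * Fintype.card U * (α * ε) ≤ (1 - α) / α)
    {e : SCV U k × SCV U k} (he : e ∈ scE U k S) :
    ∑ p, scRoute S α ε c p e ≤ scCap U k S α ε e := by
  have pair {p : SCV U k × SCV U k} (he1 : e ∈ scE1 U k S) (hp1 : p ∉ scE1 U k S)
      (hp : scTraffic S α ε p ≤ 1 - α)
      (hB : ∀ q ∉ ({e, p} : Finset _), scRoute S α ε c q e = 0) :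
      ∑ q, scRoute S α ε c q e ≤ scCap U k S α ε e := by
    refine (sum_scRoute_le h0 h1 hε0 {e, p} hB).trans ?_
    rw [Finset.sum_pair (ne_of_mem_of_not_mem he1 hp1), scTraffic_of_mem he,
      scCap_of_mem_scE1 he1]
    linarith
  have hαε : α * ε ≤ 1 - α := by
    rw [le_div_iff₀ h0] at hε
    linarith
  rcases mem_scE.1 he with h | ⟨u, rfl⟩ | ⟨u, rfl⟩ | ⟨i, rfl⟩
  · rcases mem_scE1.1 h with ⟨u, i, -, rfl⟩ | ⟨u, i, -, rfl⟩ | ⟨i, rfl⟩ | ⟨i, rfl⟩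
    · refine pair (p := (scVu u, scT U k)) h (scVu_scT_notMem_scE1 u) ?_ fun q hq => ?_
      · rwa [scTraffic_of_mem (mem_scE.2 (by simp)), scCap_scVu]
      · simp only [Finset.mem_insert, Finset.mem_singleton, not_or] at hq
        refine scRoute_eq_zero (fun _ => Ne.symm hq.1) ?_ ?_ ?_ <;> rintro w rfl <;>
          grind [scVu, scVu', scVS, scZS, scT]
    · refine pair (p := (scVu' u, scT U k)) h (scVu'_scT_notMem_scE1 u) ?_ fun q hq => ?_
      · rwa [scTraffic_of_mem (mem_scE.2 (by simp)), scCap_scVu']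
      · simp only [Finset.mem_insert, Finset.mem_singleton, not_or] at hq
        refine scRoute_eq_zero (fun _ => Ne.symm hq.1) ?_ ?_ ?_ <;> rintro w rfl <;>
          grind [scVu, scVu', scVS, scZS, scT]
    all_goals
      refine pair (p := (scVS i, scT U k)) h (scVS_scT_notMem_scE1 i) ?_ fun q hq => ?_
      · rw [scTraffic_of_mem (mem_scE.2 (by simp)), scCap_scVS, mul_div_cancel₀ _ h0.ne']
      · simp only [Finset.mem_insert, Finset.mem_singleton, not_or] at hq
        refine scRoute_eq_zero (fun _ => Ne.symm hq.1) ?_ ?_ ?_ <;> rintro w rfl <;>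
          grind [scVu, scVu', scVS, scZS, scT]
  · refine (sum_scRoute_le h0 h1 hε0 ∅ fun q _ => ?_).trans ?_
    · refine scRoute_eq_zero (fun hq => (ne_of_mem_of_not_mem hq (scVu_scT_notMem_scE1 u)).symm)
        ?_ ?_ ?_ <;> intro w _ <;> simp [scVu, scVu', scVS, scZS, scT]
    · rw [Finset.sum_empty, scCap_scVu]
      exact hε0.le
  · refine (sum_scRoute_le h0 h1 hε0 ∅ fun q _ => ?_).trans ?_
    · refine scRoute_eq_zero (fun hq => (ne_of_mem_of_not_mem hq (scVu'_scT_notMem_scE1 u)).symm)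
        ?_ ?_ ?_ <;> intro w _ <;> simp [scVu, scVu', scVS, scZS, scT]
    · rw [Finset.sum_empty, scCap_scVu']
      exact hε0.le
  · refine (sum_scRoute_le h0 h1 hε0 (scEU U k) fun q hq => ?_).trans ?_
    · refine scRoute_eq_zero (fun hq => (ne_of_mem_of_not_mem hq (scVS_scT_notMem_scE1 i)).symm)
        ?_ ?_ ?_ <;> rintro w rfl
      · exact absurd hq (by simp [scEU])
      · exact absurd hq (by simp [scEU])
      · simp [scVS, scZS, scT]
    · rw [scCap_scVS]
      exact (sum_scTraffic_scEU_le h0 hε0).trans hεU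

theorem exists_routable_of_cover {φ : ℕ} (h0 : 0 < α) (h1 : α < 1) (hε0 : 0 < ε)
    (hε : ε ≤ (1 - α) / α) (hεU : 2 * Fintype.card U * (α * ε) ≤ (1 - α) / α)
    {C : Finset (Fin k)} (hcard : C.card ≤ φ) (hC : ∀ u : U, ∃ i ∈ C, u ∈ S i) :
    ∃ A ⊆ scE U k S, Routable (scE U k S) (scCap U k S α ε) (scTraffic S α ε) A ∧
      A.card ≤ (scE1 U k S).card + φ := by
  choose c hcC hc using hC
  refine ⟨scE1 U k S ∪ C.image fun i => (scVS i, scT U k), Finset.union_subset scE1_subset_scE ?_,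
    ⟨scRoute S α ε c, scRoute_isFlow hc h0 h1 hε0,
      fun e he => sum_scRoute_le_scCap h0 h1 hε0 hε hεU he,
      fun e _ heA => Finset.sum_eq_zero fun p _ => ?_⟩, ?_⟩
  · exact Finset.image_subset_iff.2 fun i _ => mem_scE.2 (by simp)
  · by_contra hne
    obtain h | ⟨u, rfl⟩ := mem_of_scRoute_ne_zero hc hne
    · exact heA (Finset.mem_union_left _ h)
    · exact heA (Finset.mem_union_right _ (Finset.mem_image_of_mem _ (hcC u)))
  · exact (Finset.card_union_le _ _).trans
      (Nat.add_le_add_left (Finset.card_image_le.trans hcard) _)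

end SetCover

theorem stmt17 (U : Type*) [Fintype U] [DecidableEq U] [Nonempty U]
    (k : ℕ) (S : Fin k → Finset U) (hcov : ∀ u : U, ∃ i, u ∈ S i) (φ : ℕ)
    (α ε : ℚ) (h0 : 0 < α) (h1 : α < 1) (hε0 : 0 < ε)
    (hε1 : ε ≤ min ((1 - α) / (2 * α ^ 2 * (Fintype.card U : ℚ))) ((1 - α) / α)) :
    (∃ A ⊆ scE U k S,
        Routable (scE U k S) (scCap U k S α ε)
          (fun p => α * trafficTE (scE U k S) (scCap U k S α ε) p) A ∧
        A.card ≤ (scE1 U k S).card + φ) ↔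
      ∃ C : Finset (Fin k), C.card ≤ φ ∧ ∀ u : U, ∃ i ∈ C, u ∈ S i := by
  obtain ⟨hεU, hε⟩ := le_min_iff.1 hε1
  refine ⟨fun ⟨A, _, hr, hcard⟩ => exists_cover_of_routable hcov h0 hε0 hr hcard,
    fun ⟨C, hcard, hC⟩ => exists_routable_of_cover h0 h1 hε0 hε ?_ hcard hC⟩
  have hU : (0 : ℚ) < Fintype.card U := mod_cast Fintype.card_pos
  rw [le_div_iff₀ (by positivity)] at hεU
  rw [le_div_iff₀ h0]
  linarith
end

section
/- Let G=(V,E) be a digraph with uniform positive capacities cap(e) = c for all e ∈ E and some rational c > 0, and let α ∈ (0,1) be rational. Then the minimum of Σ_{e∈E} x(e) over the LP feasible region P for (G,cap,α) equals α·|E|: every (x,f) ∈ P satisfies Σ_{e∈E} x(e) ≥ α·|E|, and the point with x(e) = α for all e ∈ E and f_k(e) = α·c if e = k and 0 otherwise belongs to P and attains this value. -/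
open Finset

variable {V : Type*}

/-- The LP feasible region `P` for `(G, cap, α)`: pairs `(x, f)` where each commodity
`k ∈ E` routes a flow of value `α · cap k` and the total flow on each edge `e` is at
most `x e · cap e`, with `0 ≤ x e ≤ 1`. Coordinates outside `E` are fixed to `0`. -/
def LPRegion [Fintype V] [DecidableEq V] (E : Finset (V × V)) (cap : V × V → ℚ)
    (α : ℚ) : Set ((V × V → ℚ) × (V × V → V × V → ℚ)) :=
  {p | (∀ k, k ∉ E → p.2 k = 0) ∧
       (∀ k ∈ E, IsFlow E k.1 k.2 (α * cap k) (p.2 k)) ∧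
       (∀ e ∈ E, (∑ k ∈ E, p.2 k e) ≤ p.1 e * cap e) ∧
       (∀ e ∈ E, 0 ≤ p.1 e ∧ p.1 e ≤ 1) ∧
       (∀ e, e ∉ E → p.1 e = 0)}

/-- A basic optimal solution of the LP: an extreme point of the feasible region
minimizing `∑ e ∈ E, x e`. -/
def BasicOptimal [Fintype V] [DecidableEq V] (E : Finset (V × V)) (cap : V × V → ℚ)
    (α : ℚ) (p : (V × V → ℚ) × (V × V → V × V → ℚ)) : Prop :=
  p ∈ Set.extremePoints ℚ (LPRegion E cap α) ∧
    ∀ q ∈ LPRegion E cap α, (∑ e ∈ E, p.1 e) ≤ ∑ e ∈ E, q.1 e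

/-- The total flow over all edges is at least the value of the flow. -/
theorem IsFlow.le_sum [Fintype V] [DecidableEq V] {E : Finset (V × V)} {s t : V} {d : ℚ}
    {f : V × V → ℚ} (hf : IsFlow E s t d f) (hst : s ≠ t) : d ≤ ∑ e ∈ E, f e := by
  obtain ⟨hnonneg, -, hcons⟩ := hf
  have ht := hcons t
  rw [if_pos rfl, if_neg hst.symm, sub_zero] at ht
  have hout : 0 ≤ ∑ e ∈ E.filter (fun e => e.1 = t), f e := sum_nonneg fun e _ => hnonneg e
  have hin : ∑ e ∈ E.filter (fun e => e.2 = t), f e ≤ ∑ e ∈ E, f e :=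
    sum_le_sum_of_subset_of_nonneg (filter_subset _ _) fun e _ _ => hnonneg e
  linarith

/-- Sending `d` units along a single edge is a flow between its endpoints. -/
theorem isFlow_single_edge [Fintype V] [DecidableEq V] {E : Finset (V × V)} {k : V × V}
    (hk : k ∈ E) {d : ℚ} (hd : 0 ≤ d) :
    IsFlow E k.1 k.2 d (fun e => if e = k then d else 0) := by
  refine ⟨fun e => by dsimp only; split_ifs <;> simp [hd],
    fun e he => if_neg (ne_of_mem_of_not_mem hk he).symm, fun v => ?_⟩
  simp [hk, eq_comm]

theorem stmt18 [Fintype V] [DecidableEq V] (E : Finset (V × V))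
    (hE : ∀ e ∈ E, e.1 ≠ e.2) (cap : V × V → ℚ) (c : ℚ) (hc : 0 < c)
    (hcap : ∀ e ∈ E, cap e = c) (α : ℚ) (h0 : 0 < α) (h1 : α < 1) :
    (∀ p ∈ LPRegion E cap α, α * (E.card : ℚ) ≤ ∑ e ∈ E, p.1 e) ∧
      ((fun e => if e ∈ E then α else 0,
          fun k e => if k ∈ E ∧ e = k then α * c else 0) ∈ LPRegion E cap α) ∧
      (∑ e ∈ E, (if e ∈ E then α else 0 : ℚ)) = α * (E.card : ℚ) := by
  refine ⟨?_, ⟨fun k hk => ?_, fun k hk => ?_, fun e he => ?_, fun e he => ?_, fun e he => ?_⟩, ?_⟩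
  · rintro ⟨x, f⟩ ⟨-, hflow, hload, -, -⟩
    have hvalue : ∑ k ∈ E, α * c ≤ ∑ k ∈ E, ∑ e ∈ E, f k e :=
      sum_le_sum fun k hk => hcap k hk ▸ (hflow k hk).le_sum (hE k hk)
    have hcapacity : ∑ e ∈ E, ∑ k ∈ E, f k e ≤ ∑ e ∈ E, x e * c :=
      sum_le_sum fun e he => hcap e he ▸ hload e he
    rw [sum_comm, sum_const, nsmul_eq_mul] at hvalue
    rw [← sum_mul] at hcapacity
    refine le_of_mul_le_mul_right ?_ hc
    linarith
  · funext e
    simp [hk]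
  · simpa [hk, hcap k hk] using isFlow_single_edge hk (mul_pos h0 hc).le
  · simp [he, hcap e he, ite_and]
  · simp [he, h0.le, h1.le]
  · simp [he]
  · rw [sum_congr rfl fun e he => if_pos he, sum_const, nsmul_eq_mul, mul_comm]
end

section
/- Let α ∈ (0,1) be rational, let k ≥ 1 be a rational such that ℓ := (1/α − 1)·k is a positive integer, and let G be the directed multigraph with two vertices s, t and edge set E = {e_0, e_1, …, e_ℓ}, where every edge has src = s and dst = t, cap(e_0) = k, and cap(e_i) = 1 for 1 ≤ i ≤ ℓ. Then the singleton {e_0} is a feasible MMCFS solution for (G,cap,α), hence an optimal one of cardinality 1, and the trivial feasible solution E satisfies |E| = 1 + ((1−α)/α)·k, which equals the bound 1 + ((1−α)/α)·(max_{e∈E} cap(e))/(min_{e∈E} cap(e)). -/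
open Finset

/-- The per-edge demand function `D` is routable in `A` in the directed multigraph
given by `src`, `dst` on the edge type `K`, with capacities `cap`. -/
def MRoutable {V K : Type*} [Fintype V] [DecidableEq V] [Fintype K] [DecidableEq K]
    (src dst : K → V) (cap : K → ℚ) (D : K → ℚ) (A : Finset K) : Prop :=
  ∃ f : K → K → ℚ,
    (∀ k e, 0 ≤ f k e) ∧
    (∀ (k : K) (v : V),
      ((∑ e ∈ Finset.univ.filter (fun e => dst e = v), f k e) -
          ∑ e ∈ Finset.univ.filter (fun e => src e = v), f k e) =
        (if v = dst k then D k else 0) - (if v = src k then D k else 0)) ∧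
    (∀ e, (∑ k, f k e) ≤ cap e) ∧
    (∀ e, e ∉ A → (∑ k, f k e) = 0)

/-- `A` is a feasible MMCFS solution in the multigraph setting: the demand
`k ↦ α · cap k` is routable in `A`. -/
def MFeasible {V K : Type*} [Fintype V] [DecidableEq V] [Fintype K] [DecidableEq K]
    (src dst : K → V) (cap : K → ℚ) (α : ℚ) (A : Finset K) : Prop :=
  MRoutable src dst cap (fun k => α * cap k) A

/-- A demand routable in `A` is routable in every larger edge set. -/
theorem MRoutable.mono {V K : Type*} [Fintype V] [DecidableEq V] [Fintype K] [DecidableEq K]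
    {src dst : K → V} {cap D : K → ℚ} {A B : Finset K} (hAB : A ⊆ B)
    (h : MRoutable src dst cap D A) : MRoutable src dst cap D B := by
  obtain ⟨f, hf, hflow, hcap, hA⟩ := h
  exact ⟨f, hf, hflow, hcap, fun e he => hA e fun h => he (hAB h)⟩

/-- Between two vertices joined by parallel edges, a demand whose total is at most the capacity of
a single edge is routable in that edge. -/
theorem mRoutable_singleton_of_parallel {K : Type*} [Fintype K] [DecidableEq K]
    {cap D : K → ℚ} (e₀ : K) (hcap : ∀ e, 0 ≤ cap e) (hD : ∀ e, 0 ≤ D e)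
    (h : ∑ e, D e ≤ cap e₀) :
    MRoutable (fun _ : K => (false : Bool)) (fun _ => true) cap D {e₀} := by
  refine ⟨fun i e => if e = e₀ then D i else 0, fun i e => ?_, fun i v => ?_, fun e => ?_,
    fun e he => ?_⟩
  · dsimp only
    split_ifs
    exacts [hD i, le_rfl]
  · cases v <;> simp
  · by_cases he : e = e₀
    · simpa [he] using h
    · simpa [he] using hcap e
  · have : e ≠ e₀ := by simpa using he
    simp [this]

/-- Between two vertices joined by parallel edges, a demand that is nonzero somewhere is not
routable in the empty edge set. -/
theorem nonempty_of_mRoutable_parallel {K : Type*} [Fintype K] [DecidableEq K]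
    {cap D : K → ℚ} {A : Finset K}
    (h : MRoutable (fun _ : K => (false : Bool)) (fun _ => true) cap D A)
    {i : K} (hi : D i ≠ 0) : A.Nonempty := by
  rw [Finset.nonempty_iff_ne_empty]
  rintro rfl
  obtain ⟨f, hf, hflow, -, hA⟩ := h
  have hzero : ∀ e, f i e = 0 := fun e =>
    (Finset.sum_eq_zero_iff_of_nonneg fun j _ => hf j e).1 (hA e (by simp)) i (Finset.mem_univ i)
  have := hflow i true
  simp [hzero] at this
  exact hi this.symm

theorem stmt19 (α : ℚ) (h0 : 0 < α) (h1 : α < 1) (k : ℚ) (hk : 1 ≤ k)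
    (ℓ : ℕ) (hℓ : 0 < ℓ) (hℓdef : (ℓ : ℚ) = (1 / α - 1) * k)
    (cap : Fin (ℓ + 1) → ℚ) (hcap0 : cap 0 = k)
    (hcap1 : ∀ i : Fin (ℓ + 1), i ≠ 0 → cap i = 1) :
    MFeasible (fun _ : Fin (ℓ + 1) => (false : Bool)) (fun _ => true) cap α {0} ∧
      ({0} : Finset (Fin (ℓ + 1))).card = 1 ∧
      (∀ B : Finset (Fin (ℓ + 1)),
        MFeasible (fun _ : Fin (ℓ + 1) => (false : Bool)) (fun _ => true) cap α B →
          ({0} : Finset (Fin (ℓ + 1))).card ≤ B.card) ∧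
      MFeasible (fun _ : Fin (ℓ + 1) => (false : Bool)) (fun _ => true) cap α
        Finset.univ ∧
      ((Finset.univ : Finset (Fin (ℓ + 1))).card : ℚ) = 1 + (1 - α) / α * k ∧
      1 + (1 - α) / α * k =
        1 + (1 - α) / α *
          (Finset.univ.sup' Finset.univ_nonempty cap /
            Finset.univ.inf' Finset.univ_nonempty cap) := by
  have hk0 : 0 < k := by linarith
  have hpos : ∀ i, 0 < cap i := fun i => by
    by_cases hi : i = 0
    · rw [hi, hcap0]; exact hk0
    · rw [hcap1 i hi]; exact one_pos
  have hsum : ∑ i, cap i = k + ℓ := by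
    rw [Fin.sum_univ_succ, hcap0, Finset.sum_congr rfl fun i _ => hcap1 _ (Fin.succ_ne_zero i)]
    simp
  have hfeas : MFeasible (fun _ : Fin (ℓ + 1) => (false : Bool)) (fun _ => true) cap α {0} := by
    refine mRoutable_singleton_of_parallel 0 (fun e => (hpos e).le)
      (fun e => (mul_pos h0 (hpos e)).le) (le_of_eq ?_)
    rw [← Finset.mul_sum, hsum, hcap0, hℓdef]
    field_simp
    ring
  have hsup : Finset.univ.sup' Finset.univ_nonempty cap = k := by
    refine le_antisymm (Finset.sup'_le _ _ fun i _ => ?_)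
      (hcap0 ▸ Finset.le_sup' cap (Finset.mem_univ 0))
    by_cases hi : i = 0
    · rw [hi, hcap0]
    · rwa [hcap1 i hi]
  have hinf : Finset.univ.inf' Finset.univ_nonempty cap = 1 := by
    have hlast : Fin.last ℓ ≠ 0 := fun h => hℓ.ne' (by simpa using congrArg Fin.val h)
    refine le_antisymm (hcap1 _ hlast ▸ Finset.inf'_le cap (Finset.mem_univ (Fin.last ℓ)))
      (Finset.le_inf' _ _ fun i _ => ?_)
    by_cases hi : i = 0
    · rwa [hi, hcap0]
    · rw [hcap1 i hi]
  refine ⟨hfeas, Finset.card_singleton 0, fun B hB => ?_,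
    MRoutable.mono (Finset.subset_univ _) hfeas, ?_, ?_⟩
  · rw [Finset.card_singleton, Nat.one_le_iff_ne_zero, Finset.card_ne_zero]
    exact nonempty_of_mRoutable_parallel hB (mul_pos h0 (hpos 0)).ne'
  · rw [Finset.card_univ, Fintype.card_fin, Nat.cast_add, hℓdef]
    field_simp
    push_cast
    ring
  · rw [hsup, hinf, div_one]
end
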